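/- Let Σ be a finite alphabet and φ : Σ* → Σ* a nonerasing morphism. Then there exists an integer n ≥ 1 such that the morphism φ^n is weakly 1-periodic, i.e.: (i) for every preperiodic letter b of finite order k, every letter of order k occurring in φ^n(b) is periodic; and (ii) for every periodic letter b of finite order k, the letter of order k occurring in φ^n(b) is b itself. (Here orders and the periodic/preperiodic dichotomy are taken with respect to φ; they are unchanged when φ is replaced by a power of φ.) -/

import Mathlib

open Asymptotics Filter

/-- Apply a morphism (given by its values on letters) to a finite word. -/
def substWord {A : Type*} (φ : A → List A) : List A → List A
  | [] => []
  | a :: w => φ a ++ substWord φ w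

/-- The `n`-th iterate of a morphism applied to a word. -/
def iterWord {A : Type*} (φ : A → List A) (n : ℕ) (w : List A) : List A :=
  (substWord φ)^[n] w

/-- The letter `b` has finite order `k`: `k ≥ 1` and `|φ^n(b)| = Θ(n^(k−1))`. -/
def HasOrder {A : Type*} (φ : A → List A) (b : A) (k : ℕ) : Prop :=
  1 ≤ k ∧
    (fun n => ((iterWord φ n [b]).length : ℝ)) =Θ[atTop] (fun n => (n : ℝ) ^ (k - 1))

/-- A letter of finite order is periodic if it occurs in some `φ^m` of
itself (`m ≥ 1`). -/
def PeriodicLetter {A : Type*} (φ : A → List A) (b : A) : Prop :=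
  ∃ m : ℕ, 1 ≤ m ∧ b ∈ iterWord φ m [b]

theorem substWord_append {A : Type*} (φ : A → List A) (u v : List A) :
    substWord φ (u ++ v) = substWord φ u ++ substWord φ v := by
  induction u with
  | nil => rfl
  | cons a u ih => simp [substWord, ih]

theorem iterWord_append {A : Type*} (φ : A → List A) (n : ℕ) (u v : List A) :
    iterWord φ n (u ++ v) = iterWord φ n u ++ iterWord φ n v := by
  induction n generalizing u v with
  | zero => rfl
  | succ n ih =>
    simp only [iterWord, Function.iterate_succ_apply] at ih ⊢
    rw [substWord_append, ih]

theorem iterWord_add {A : Type*} (φ : A → List A) (m n : ℕ) (w : List A) :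
    iterWord φ (m + n) w = iterWord φ n (iterWord φ m w) := by
  rw [add_comm]
  exact Function.iterate_add_apply _ _ _ _

/-- An occurrence of `c` in `w` splits every iterate of `w`. -/
theorem exists_iterWord_eq_append {A : Type*} (φ : A → List A) {c : A} {w : List A}
    (h : c ∈ w) : ∃ u v : List A, ∀ n,
      iterWord φ n w = iterWord φ n u ++ (iterWord φ n [c] ++ iterWord φ n v) := by
  obtain ⟨u, v, rfl⟩ := List.append_of_mem h
  refine ⟨u, v, fun n => ?_⟩
  rw [← iterWord_append, ← iterWord_append]
  rfl

theorem length_iterWord_singleton_le {A : Type*} (φ : A → List A) {c : A} {w : List A}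
    (h : c ∈ w) (n : ℕ) : (iterWord φ n [c]).length ≤ (iterWord φ n w).length := by
  obtain ⟨u, v, huv⟩ := exists_iterWord_eq_append φ h
  rw [huv n, List.length_append, List.length_append]
  omega

theorem mem_iterWord_trans {A : Type*} (φ : A → List A) {b c d : A} {m n : ℕ}
    (hc : c ∈ iterWord φ m [b]) (hd : d ∈ iterWord φ n [c]) :
    d ∈ iterWord φ (m + n) [b] := by
  obtain ⟨u, v, huv⟩ := exists_iterWord_eq_append φ hc
  rw [iterWord_add, huv n]
  simp [hd]

theorem mem_iterWord_mul {A : Type*} (φ : A → List A) {b : A} {p : ℕ}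
    (h : b ∈ iterWord φ p [b]) (t : ℕ) : b ∈ iterWord φ (p * t) [b] := by
  induction t with
  | zero => simp [iterWord]
  | succ t ih => exact mem_iterWord_trans φ ih h

theorem length_add_length_le {A : Type*} (φ : A → List A) {b c : A} {w : List A} {r : ℕ}
    (hc : c ∈ w) (hb : b ∈ iterWord φ r w) (hbc : b ∉ iterWord φ r [c]) (n : ℕ) :
    (iterWord φ n [b]).length + (iterWord φ (r + n) [c]).length ≤
      (iterWord φ (r + n) w).length := by
  obtain ⟨u, v, huv⟩ := exists_iterWord_eq_append φ hc
  rw [huv] at hb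
  rw [huv (r + n), List.length_append, List.length_append]
  simp only [List.mem_append, hbc, false_or] at hb
  rcases hb with hb | hb
  all_goals
    have := length_iterWord_singleton_le φ hb n
    rw [← iterWord_add] at this
    omega

theorem exists_path_of_mem_iterWord {A : Type*} (φ : A → List A) {b c : A} {n : ℕ}
    (h : c ∈ iterWord φ n [b]) :
    ∃ x : ℕ → A, x 0 = b ∧ x n = c ∧
      ∀ i j, i ≤ j → j ≤ n → x j ∈ iterWord φ (j - i) [x i] := by
  induction n generalizing c with
  | zero =>
    refine ⟨fun _ => b, rfl, ?_, fun i j _ hj => ?_⟩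
    · simpa [iterWord, eq_comm] using h
    · obtain rfl : j = 0 := by omega
      simp [iterWord]
  | succ n ih =>
    have key : ∀ w : List A, c ∈ substWord φ w → ∃ d ∈ w, c ∈ iterWord φ 1 [d] := by
      intro w
      induction w with
      | nil => simp [substWord]
      | cons a w ihw =>
        intro hc
        simp only [substWord, List.mem_append] at hc
        rcases hc with hc | hc
        · exact ⟨a, by simp, by simpa [iterWord, substWord] using hc⟩
        · obtain ⟨d, hd, hcd⟩ := ihw hc
          exact ⟨d, by simp [hd], hcd⟩
    rw [iterWord_add] at h
    obtain ⟨d, hd, hcd⟩ := key _ h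
    obtain ⟨x, hx0, hxn, hx⟩ := ih hd
    refine ⟨fun i => if i ≤ n then x i else c, by simpa using hx0, by simp, ?_⟩
    intro i j hij hj
    by_cases hjn : j ≤ n
    · simpa [hjn, hij.trans hjn] using hx i j hij hjn
    obtain rfl : j = n + 1 := by omega
    by_cases hin : i ≤ n
    · have h1 := hx i n hin le_rfl
      rw [hxn] at h1
      have h2 := mem_iterWord_trans φ h1 hcd
      rw [show n - i + 1 = n + 1 - i by omega] at h2
      simpa [hin] using h2
    · obtain rfl : i = n + 1 := by omega
      simp [iterWord]

/-- If the increments of `f` along steps of length `q` grow at least like `n ^ d`, then `f`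
is not bounded by a shift of a function that is `O(n ^ d)`. -/
theorem false_of_increments {f F g : ℕ → ℕ} {q s i d : ℕ}
    (hstep : ∀ n, f n + g (s + n) ≤ f (n + q)) (hfF : ∀ n, f n ≤ F (i + n))
    (hF : (fun n => (F n : ℝ)) =O[atTop] (fun n : ℕ => (n : ℝ) ^ d))
    (hg : (fun n : ℕ => (n : ℝ) ^ d) =O[atTop] (fun n => (g n : ℝ)))
    (hq : 1 ≤ q) : False := by
  obtain ⟨C, hC0, hC⟩ := hF.exists_pos
  obtain ⟨D, hD0, hD⟩ := hg.exists_pos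
  obtain ⟨N, hN⟩ := eventually_atTop.1 (hC.bound.and hD.bound)
  have hFN : ∀ n ≥ N, (F n : ℝ) ≤ C * (n : ℝ) ^ d := fun n hn => by
    simpa using (hN n hn).1
  have hgN : ∀ n ≥ N, (n : ℝ) ^ d ≤ D * (g n : ℝ) := fun n hn => by
    simpa using (hN n hn).2
  have hsum : ∀ K M : ℕ, (M : ℝ) * (K : ℝ) ^ d ≤ D * f (N + q * (K + M)) := by
    intro K M
    induction M with
    | zero => simp only [Nat.cast_zero, zero_mul]; positivity
    | succ M ih =>
      have h1 := hstep (N + q * (K + M))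
      rw [show N + q * (K + M) + q = N + q * (K + (M + 1)) by ring] at h1
      have h1' : (f (N + q * (K + M)) : ℝ) + g (s + (N + q * (K + M))) ≤
          f (N + q * (K + (M + 1))) := by exact_mod_cast h1
      have h2 := hgN (s + (N + q * (K + M))) (by omega)
      have h3 : (K : ℝ) ^ d ≤ ((s + (N + q * (K + M)) : ℕ) : ℝ) ^ d := by
        have : K ≤ s + (N + q * (K + M)) := by nlinarith
        gcongr
      have h4 := mul_le_mul_of_nonneg_left h1' hD0.le
      push_cast at *
      linarith
  obtain ⟨K, hK⟩ := exists_nat_gt (D * (C * ((i + N + 2 * q : ℕ) : ℝ) ^ d))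
  have hK0 : (0 : ℝ) < K := lt_of_le_of_lt (by positivity) hK
  have hK1 : 1 ≤ K := by exact_mod_cast hK0
  have h1 : (f (N + q * (K + K)) : ℝ) ≤ C * (((i + N + 2 * q : ℕ) : ℝ) ^ d * (K : ℝ) ^ d) := by
    calc (f (N + q * (K + K)) : ℝ) ≤ F (i + (N + q * (K + K))) := by exact_mod_cast hfF _
      _ ≤ C * ((i + (N + q * (K + K)) : ℕ) : ℝ) ^ d := hFN _ (by omega)
      _ ≤ C * (((i + N + 2 * q) * K : ℕ) : ℝ) ^ d := by
        have : i + (N + q * (K + K)) ≤ (i + N + 2 * q) * K := by nlinarith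
        gcongr
      _ = _ := by rw [Nat.cast_mul, mul_pow]
  have h2 := (hsum K K).trans (mul_le_mul_of_nonneg_left h1 hD0.le)
  have h3 : (0 : ℝ) < (K : ℝ) ^ d := by positivity
  nlinarith [mul_lt_mul_of_pos_right hK h3]

/-- Let `a` have order `k` and let `b` be a descendant of `a` occurring in `φ ^ (m + r) (b)`.
Then `b` occurs in `φ ^ r (c)` for every letter `c` of order `k` in `φ ^ m (b)`. -/
theorem mem_iterWord_of_hasOrder {A : Type*} (φ : A → List A) {a b c : A} {i m r k : ℕ}
    (ha : HasOrder φ a k) (hab : b ∈ iterWord φ i [a]) (hmr : 1 ≤ m + r)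
    (hbb : b ∈ iterWord φ (m + r) [b]) (hbc : c ∈ iterWord φ m [b]) (hc : HasOrder φ c k) :
    b ∈ iterWord φ r [c] := by
  by_contra hcb
  rw [iterWord_add] at hbb
  refine false_of_increments (f := fun n => (iterWord φ n [b]).length)
    (F := fun n => (iterWord φ n [a]).length) (g := fun n => (iterWord φ n [c]).length)
    (s := r) (i := i) (fun n => ?_) (fun n => ?_) ha.2.1 hc.2.2 hmr
  · have := length_add_length_le φ hbc hbb hcb n
    rwa [← iterWord_add, show m + (r + n) = n + (m + r) by ring] at this
  · have := length_iterWord_singleton_le φ hab n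
    rwa [← iterWord_add] at this

theorem PeriodicLetter.of_mem_iterWord {A : Type*} {φ : A → List A} {a b c : A} {i m k : ℕ}
    (hb : PeriodicLetter φ b) (ha : HasOrder φ a k) (hab : b ∈ iterWord φ i [a])
    (hbc : c ∈ iterWord φ m [b]) (hc : HasOrder φ c k) : PeriodicLetter φ c := by
  obtain ⟨p, hp, hbp⟩ := hb
  have hm : m + 1 ≤ p * (m + 1) := Nat.le_mul_of_pos_left _ hp
  have hq : m + (p * (m + 1) - m) = p * (m + 1) := by omega
  have hcb : b ∈ iterWord φ (p * (m + 1) - m) [c] :=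
    mem_iterWord_of_hasOrder φ ha hab (by omega) (by rw [hq]; exact mem_iterWord_mul φ hbp _) hbc hc
  exact ⟨_, by omega, mem_iterWord_trans φ hcb hbc⟩

theorem exists_periodicLetter_of_mem_iterWord {A : Type*} [Fintype A] (φ : A → List A)
    {b c : A} {n : ℕ} (hn : Fintype.card A ≤ n) (h : c ∈ iterWord φ n [b]) :
    ∃ (d : A) (i m : ℕ), PeriodicLetter φ d ∧ d ∈ iterWord φ i [b] ∧ c ∈ iterWord φ m [d] := by
  obtain ⟨x, hx0, hxn, hx⟩ := exists_path_of_mem_iterWord φ h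
  obtain ⟨i, j, hij, hxij⟩ :=
    Fintype.exists_ne_map_eq_of_card_lt (fun i : Fin (n + 1) => x i) (by simp; omega)
  wlog hlt : i < j generalizing i j
  · exact this j i hij.symm hxij.symm (lt_of_le_of_ne (not_lt.1 hlt) hij.symm)
  have hlt' : (i : ℕ) < j := hlt
  have hjn : (j : ℕ) ≤ n := by omega
  have h1 := hx i j hlt'.le hjn
  have h2 := hx 0 i (Nat.zero_le _) (by omega)
  have h3 := hx i n (by omega) le_rfl
  rw [← hxij] at h1
  rw [hx0] at h2
  rw [hxn] at h3
  exact ⟨x i, _, _, ⟨_, by omega, h1⟩, h2, h3⟩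

theorem exists_common_period {A : Type*} [Fintype A] (φ : A → List A) :
    ∃ n : ℕ, 1 ≤ n ∧ ∀ b, PeriodicLetter φ b → b ∈ iterWord φ n [b] := by
  have h : ∀ b, ∃ p : ℕ, 1 ≤ p ∧ (PeriodicLetter φ b → b ∈ iterWord φ p [b]) := by
    intro b
    by_cases hb : PeriodicLetter φ b
    · obtain ⟨p, hp, hbp⟩ := hb
      exact ⟨p, hp, fun _ => hbp⟩
    · exact ⟨1, le_rfl, fun h => absurd h hb⟩
  choose p hp hbp using h
  refine ⟨∏ b, p b, Nat.succ_le_of_lt (Finset.prod_pos fun b _ => hp b), fun b hb => ?_⟩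
  obtain ⟨t, ht⟩ := Finset.dvd_prod_of_mem p (Finset.mem_univ b)
  rw [ht]
  exact mem_iterWord_mul φ (hbp b hb) t

/-- There exists `n ≥ 1` such that `φ^n` is weakly 1-periodic (orders and the
periodic/preperiodic dichotomy taken with respect to `φ`):
(i) for every preperiodic letter `b` of finite order `k`, every letter of
order `k` in `φ^n(b)` is periodic; (ii) for every periodic letter `b` of
finite order `k`, the letter of order `k` in `φ^n(b)` is `b` itself. -/
theorem stmt9 {A : Type*} [Fintype A] (φ : A → List A)
    (hφ : ∀ b : A, φ b ≠ []) :
    ∃ n : ℕ, 1 ≤ n ∧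
      (∀ (b : A) (k : ℕ), HasOrder φ b k → ¬ PeriodicLetter φ b →
        ∀ c ∈ iterWord φ n [b], HasOrder φ c k → PeriodicLetter φ c) ∧
      (∀ (b : A) (k : ℕ), HasOrder φ b k → PeriodicLetter φ b →
        ∀ c ∈ iterWord φ n [b], HasOrder φ c k → c = b) := by
  obtain ⟨p, hp, hper⟩ := exists_common_period φ
  have hle : Fintype.card A + 1 ≤ p * (Fintype.card A + 1) := Nat.le_mul_of_pos_left _ hp
  refine ⟨p * (Fintype.card A + 1), by omega, ?_, ?_⟩
  · intro b k hb _ c hc hck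
    obtain ⟨d, i, m, hd, hbd, hdc⟩ := exists_periodicLetter_of_mem_iterWord φ (by omega) hc
    exact hd.of_mem_iterWord hb hbd hdc hck
  · intro b k hb hbper c hc hck
    have hbc : b ∈ iterWord φ 0 [c] :=
      mem_iterWord_of_hasOrder φ (i := 0) (m := p * (Fintype.card A + 1)) hb
        (by simp [iterWord]) (by omega)
        (mem_iterWord_mul φ (hper b hbper) _) hc hck
    simpa [iterWord, eq_comm] using hbc
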